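/- arXiv:math/0511260 — 3 statements merged into one kernel-verified Lean document; each statement's English description precedes it below -/
import Mathlib

section
/- The linear map γ_A: Λ²(A) → Ω¹(A) determined by γ_A(a∧b) = a·d_A(b) − b·d_A(a) is well defined and surjective, and its kernel equals T₀(A). -/
set_option linter.unusedSectionVars false
set_option synthInstance.maxHeartbeats 1000000
set_option maxHeartbeats 1000000
open scoped TensorProduct

namespace CurrentPaper

variable (K : Type*) [Field K] [CharZero K]

section Wedge

variable (V : Type*) [AddCommGroup V] [Module K V]

/-- `x ∧ y = (1/2)(x ⊗ y - y ⊗ x)` inside `V ⊗ V`. -/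
noncomputable def wedge (x y : V) : V ⊗[K] V := (2 : K)⁻¹ • (x ⊗ₜ[K] y - y ⊗ₜ[K] x)

/-- `x ∨ y = (1/2)(x ⊗ y + y ⊗ x)` inside `V ⊗ V`. -/
noncomputable def vee (x y : V) : V ⊗[K] V := (2 : K)⁻¹ • (x ⊗ₜ[K] y + y ⊗ₜ[K] x)

/-- `Λ²(V)` realized as the subspace of skew-symmetric tensors of `V ⊗ V`. -/
def lambda2 : Submodule K (V ⊗[K] V) := Submodule.span K {t | ∃ x y : V, t = wedge K V x y}

/-- `S²(V)` realized as the subspace of symmetric tensors of `V ⊗ V`. -/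
def sym2 : Submodule K (V ⊗[K] V) := Submodule.span K {t | ∃ x y : V, t = vee K V x y}

variable {V}

lemma wedge_mem (x y : V) : wedge K V x y ∈ lambda2 K V := Submodule.subset_span ⟨x, y, rfl⟩

lemma vee_mem (x y : V) : vee K V x y ∈ sym2 K V := Submodule.subset_span ⟨x, y, rfl⟩

end Wedge

section LieRelaxed

variable (L : Type*) [LieRing L] [Module K L]

/-- `∂(u ∧ v ∧ w) = ⁅u,v⁆ ∧ w + ⁅v,w⁆ ∧ u + ⁅w,u⁆ ∧ v`. -/
noncomputable def dd (u v w : L) : L ⊗[K] L :=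
  wedge K L ⁅u, v⁆ w + wedge K L ⁅v, w⁆ u + wedge K L ⁅w, u⁆ v

/-- `B₂(L)`, the space of 2-boundaries, i.e. the image of `∂ : Λ³(L) → Λ²(L)`. -/
def B2 : Submodule K (L ⊗[K] L) := Submodule.span K {t | ∃ u v w : L, t = dd K L u v w}

variable {L}

lemma dd_mem_lambda2 (u v w : L) : dd K L u v w ∈ lambda2 K L :=
  add_mem (add_mem (wedge_mem K _ _) (wedge_mem K _ _)) (wedge_mem K _ _)

lemma dd_mem_B2 (u v w : L) : dd K L u v w ∈ B2 K L := Submodule.subset_span ⟨u, v, w, rfl⟩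

end LieRelaxed

section Lie

variable (L : Type*) [LieRing L] [LieAlgebra K L]

/-- The bracket `b : L ⊗ L → L`, `u ⊗ v ↦ ⁅u,v⁆`, as a linear map. -/
noncomputable def bracketHom : L ⊗[K] L →ₗ[K] L :=
  TensorProduct.lift (LinearMap.mk₂ K (fun u v => ⁅u, v⁆) add_lie smul_lie lie_add lie_smul)

/-- `Z₂(L) = Λ²(L) ∩ ker b`, the space of 2-cycles. -/
noncomputable def Z2 : Submodule K (L ⊗[K] L) := lambda2 K L ⊓ LinearMap.ker (bracketHom K L)

/-- The derived algebra `L' = [L,L]`, as a subspace of `L`. -/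
def derived : Submodule K L := Submodule.span K {m | ∃ u v : L, m = ⁅u, v⁆}

end Lie

section Alg

variable (A : Type*) [CommRing A] [Algebra K A]

/-- `I_A ⊆ S²(A)`: the kernel of the multiplication map `S²(A) → A`. -/
noncomputable def ia : Submodule K (A ⊗[K] A) := sym2 K A ⊓ LinearMap.ker (LinearMap.mul' K A)

/-- `T(A) ⊆ Λ²(A)`: the span of the elements `ab ∧ c + bc ∧ a + ca ∧ b`. -/
def TA : Submodule K (A ⊗[K] A) :=
  Submodule.span K
    {t | ∃ a b c : A, t = wedge K A (a*b) c + wedge K A (b*c) a + wedge K A (c*a) b}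

/-- `T₀(A) ⊆ Λ²(A)`: the span of the elements `ab ∧ c + bc ∧ a + ca ∧ b - abc ∧ 1`. -/
def T0A : Submodule K (A ⊗[K] A) :=
  Submodule.span K
    {t | ∃ a b c : A,
      t = wedge K A (a*b) c + wedge K A (b*c) a + wedge K A (c*a) b - wedge K A (a*b*c) 1}

variable {A}

lemma TA_el_mem_lambda2 (a b c : A) :
    wedge K A (a*b) c + wedge K A (b*c) a + wedge K A (c*a) b ∈ lambda2 K A :=
  add_mem (add_mem (wedge_mem K _ _) (wedge_mem K _ _)) (wedge_mem K _ _)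

lemma T0A_el_mem_lambda2 (a b c : A) :
    wedge K A (a*b) c + wedge K A (b*c) a + wedge K A (c*a) b - wedge K A (a*b*c) 1 ∈
      lambda2 K A :=
  sub_mem (TA_el_mem_lambda2 K a b c) (wedge_mem K _ _)

lemma ia_el_mem (a b : A) : vee K A a b - vee K A (a * b) 1 ∈ ia K A := by
  refine Submodule.mem_inf.mpr ⟨sub_mem (vee_mem K a b) (vee_mem K _ _), ?_⟩
  simp only [LinearMap.mem_ker, map_sub, vee, map_smul, map_add, LinearMap.mul'_apply,
    mul_one, one_mul, mul_comm b a]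
  simp

end Alg

section Current

variable (A : Type*) [CommRing A] [Algebra K A]
variable (k : Type*) [LieRing k] [LieAlgebra K k]

lemma g_smul_lie (c : K) (x y : A ⊗[K] k) : ⁅c • x, y⁆ = c • ⁅x, y⁆ := by
  rw [← algebraMap_smul A c x, ← algebraMap_smul A c ⁅x, y⁆, smul_lie]

lemma g_lie_smul (c : K) (x y : A ⊗[K] k) : ⁅x, c • y⁆ = c • ⁅x, y⁆ := by
  rw [← algebraMap_smul A c y, ← algebraMap_smul A c ⁅x, y⁆, lie_smul]

/-- The bracket of the current algebra `g = A ⊗ k`, as a `K`-linear map `g ⊗ g → g`. -/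
noncomputable def gBracket : (A ⊗[K] k) ⊗[K] (A ⊗[K] k) →ₗ[K] A ⊗[K] k :=
  TensorProduct.lift (LinearMap.mk₂ K (fun u v => ⁅u, v⁆) add_lie
    (fun c x y => g_smul_lie K A k c x y) lie_add (fun c x y => g_lie_smul K A k c x y))

/-- `Z₂(g) = Λ²(g) ∩ ker b` for the current algebra `g = A ⊗ k`. -/
noncomputable def Z2g : Submodule K ((A ⊗[K] k) ⊗[K] (A ⊗[K] k)) :=
  lambda2 K (A ⊗[K] k) ⊓ LinearMap.ker (gBracket K A k)

/-- The first summand `Λ²(A) ⊗ S²(k)` of the decomposition of `Λ²(A ⊗ k)`. -/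
abbrev M1 := (↥(lambda2 K A)) ⊗[K] (↥(sym2 K k))

/-- The second summand `A ⊗ Λ²(k)` of the decomposition of `Λ²(A ⊗ k)`. -/
abbrev M2 := A ⊗[K] (↥(lambda2 K k))

/-- The third summand `I_A ⊗ Λ²(k)` of the decomposition of `Λ²(A ⊗ k)`. -/
abbrev M3 := (↥(ia K A)) ⊗[K] (↥(lambda2 K k))

/-- The target of the isomorphism `P = (p₁,p₂,p₃)`. -/
abbrev Wspace := M1 K A k × M2 K A k × M3 K A k

variable {A k}

/-- The property characterizing the linear isomorphism
`P = (p₁,p₂,p₃) : Λ²(A ⊗ k) ≅ (Λ²(A) ⊗ S²(k)) ⊕ (A ⊗ Λ²(k)) ⊕ (I_A ⊗ Λ²(k))`: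
`p₁(ax ∧ by) = a ∧ b ⊗ x ∨ y`, `p₂(ax ∧ by) = ab ⊗ x ∧ y`,
`p₃(ax ∧ by) = (a ∨ b - ab ∨ 1) ⊗ x ∧ y`. -/
def IsDecomposition (P : ↥(lambda2 K (A ⊗[K] k)) ≃ₗ[K] Wspace K A k) : Prop :=
  ∀ (a b : A) (x y : k),
    P ⟨wedge K (A ⊗[K] k) (a ⊗ₜ x) (b ⊗ₜ y), wedge_mem K _ _⟩ =
      ((⟨wedge K A a b, wedge_mem K a b⟩ ⊗ₜ[K] ⟨vee K k x y, vee_mem K x y⟩ : M1 K A k),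
       ((a * b) ⊗ₜ[K] ⟨wedge K k x y, wedge_mem K x y⟩ : M2 K A k),
       ((⟨vee K A a b - vee K A (a * b) 1, ia_el_mem K a b⟩ ⊗ₜ[K]
          ⟨wedge K k x y, wedge_mem K x y⟩ : M3 K A k)))

end Current

end CurrentPaper

namespace CurrentPaper

section KaehlerWedge

variable (K : Type*) [Field K] [CharZero K] (A : Type*) [CommRing A] [Algebra K A]

/-- The wedge product as a bilinear map. -/
noncomputable def wedgeHom (V : Type*) [AddCommGroup V] [Module K V] :
    V →ₗ[K] V →ₗ[K] V ⊗[K] V :=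
  (2 : K)⁻¹ • (TensorProduct.mk K V V - (TensorProduct.mk K V V).flip)

@[simp]
lemma wedgeHom_apply (V : Type*) [AddCommGroup V] [Module K V] (x y : V) :
    wedgeHom K V x y = wedge K V x y := rfl

lemma wedge_swap (V : Type*) [AddCommGroup V] [Module K V] (x y : V) :
    wedge K V y x = -wedge K V x y := by
  simp only [wedge]
  rw [← smul_neg, neg_sub]

/-- The map `A ⊗ A → Ω¹(A)`, `a ⊗ b ↦ a d b - b d a`. -/
noncomputable def tensorToKaehler : A ⊗[K] A →ₗ[K] Ω[A⁄K] :=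
  let f : A →ₗ[K] A →ₗ[K] Ω[A⁄K] :=
    LinearMap.mk₂ K (fun a b => a • KaehlerDifferential.D K A b)
      (fun _ _ _ => add_smul _ _ _) (fun _ _ _ => smul_assoc _ _ _)
      (fun _ _ _ => by rw [map_add, smul_add])
      (fun c a b => by rw [Derivation.map_smul, smul_comm])
  TensorProduct.lift (f - f.flip)

lemma tensorToKaehler_tmul (a b : A) : tensorToKaehler K A (a ⊗ₜ b) =
    a • KaehlerDifferential.D K A b - b • KaehlerDifferential.D K A a := rfl

lemma tensorToKaehler_wedge (a b : A) : tensorToKaehler K A (wedge K A a b) =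
    a • KaehlerDifferential.D K A b - b • KaehlerDifferential.D K A a := by
  rw [wedge, map_smul, map_sub, tensorToKaehler_tmul, tensorToKaehler_tmul,
    inv_smul_eq_iff₀ two_ne_zero, two_smul]
  abel

lemma T0A_le_ker : T0A K A ≤ LinearMap.ker (tensorToKaehler K A) := by
  refine Submodule.span_le.2 ?_
  rintro _ ⟨a, b, c, rfl⟩
  simp only [SetLike.mem_coe, LinearMap.mem_ker, map_sub, map_add, tensorToKaehler_wedge,
    Derivation.leibniz, Derivation.map_one_eq_zero]
  module

lemma map_lambda2_eq_top : (lambda2 K A).map (tensorToKaehler K A) = ⊤ := by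
  have key : ∀ a b : A, a • KaehlerDifferential.D K A b ∈
      (lambda2 K A).map (tensorToKaehler K A) := fun a b => by
    refine ⟨(2 : K)⁻¹ • (wedge K A a b + wedge K A 1 (a * b)),
      Submodule.smul_mem _ _ (add_mem (wedge_mem K _ _) (wedge_mem K _ _)), ?_⟩
    rw [map_smul, map_add, tensorToKaehler_wedge, tensorToKaehler_wedge,
      inv_smul_eq_iff₀ two_ne_zero, two_smul, Derivation.leibniz, Derivation.map_one_eq_zero]
    module
  refine eq_top_iff.2 fun ω _ => ?_
  obtain ⟨f, rfl⟩ := KaehlerDifferential.linearCombination_surjective K A ω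
  rw [Finsupp.linearCombination_apply]
  exact Submodule.sum_mem _ fun b _ => key (f b) b

/-- The map `⨁ A d b → (A ⊗ A) / T₀(A)`, `a d b ↦ (1/2)(a ∧ b + 1 ∧ ab)`. -/
noncomputable def finsuppToQuotient : (A →₀ A) →ₗ[K] (A ⊗[K] A) ⧸ T0A K A :=
  Finsupp.lsum K fun b => (T0A K A).mkQ ∘ₗ ((2 : K)⁻¹ •
    ((wedgeHom K A).flip b + wedgeHom K A 1 ∘ₗ LinearMap.mulRight K b))

lemma finsuppToQuotient_single (a b : A) : finsuppToQuotient K A (Finsupp.single b a) =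
    (T0A K A).mkQ ((2 : K)⁻¹ • (wedge K A a b + wedge K A 1 (a * b))) := by
  rw [finsuppToQuotient, Finsupp.lsum_single]
  rfl

lemma kerTotal_le_ker : (KaehlerDifferential.kerTotal K A).restrictScalars K ≤
    LinearMap.ker (finsuppToQuotient K A) := by
  intro x hx
  suffices h : ∀ a : A, finsuppToQuotient K A (a • x) = 0 by simpa using h 1
  replace hx : x ∈ KaehlerDifferential.kerTotal K A := hx
  rw [KaehlerDifferential.kerTotal] at hx
  induction hx using Submodule.span_induction with
  | zero => simp
  | add x y _ _ hx hy => intro a; rw [smul_add, map_add, hx, hy, add_zero]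
  | smul r x _ hx => intro a; rw [smul_smul, hx]
  | mem x hx =>
    intro a
    rcases hx with (⟨⟨x, y⟩, rfl⟩ | ⟨⟨x, y⟩, rfl⟩) | ⟨r, rfl⟩
    · simp only [smul_sub, smul_add, Finsupp.smul_single, smul_eq_mul, mul_one, map_sub, map_add,
        finsuppToQuotient_single, mul_add, ← wedgeHom_apply, map_smul]
      module
    · simp only [smul_sub, smul_add, Finsupp.smul_single, smul_eq_mul, mul_one, map_sub, map_add,
        finsuppToQuotient_single]
      simp only [← map_add, ← map_sub]
      rw [Submodule.mkQ_apply, Submodule.Quotient.mk_eq_zero]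
      have h : wedge K A (x * y) a + wedge K A (y * a) x + wedge K A (a * x) y
          - wedge K A (x * y * a) 1 ∈ T0A K A := Submodule.subset_span ⟨x, y, a, rfl⟩
      convert Submodule.smul_mem _ ((2 : K)⁻¹) h using 1
      rw [wedge_swap K A a (x * y), wedge_swap K A 1 (x * y * a), mul_comm y a,
        show a * (x * y) = x * y * a by ring, show a * x * y = x * y * a by ring,
        show a * y * x = x * y * a by ring]
      module
    · rw [Finsupp.smul_single, smul_eq_mul, mul_one, finsuppToQuotient_single,
        Algebra.algebraMap_eq_smul_one, mul_smul_comm, mul_one]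
      simp only [← wedgeHom_apply, map_smul]
      rw [wedgeHom_apply, wedgeHom_apply, wedge_swap K A a 1]
      simp

/-- The map `Ω¹(A) → (A ⊗ A) / T₀(A)`, `a d b ↦ (1/2)(a ∧ b + 1 ∧ ab)`. -/
noncomputable def kaehlerToQuotient : Ω[A⁄K] →ₗ[K] (A ⊗[K] A) ⧸ T0A K A :=
  ((KaehlerDifferential.kerTotal K A).restrictScalars K).liftQ _ (kerTotal_le_ker K A) ∘ₗ
    (Submodule.Quotient.restrictScalarsEquiv K _).symm.toLinearMap ∘ₗ
      (KaehlerDifferential.quotKerTotalEquiv K A).symm.toLinearMap.restrictScalars K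

lemma kaehlerToQuotient_smul_D (a b : A) :
    kaehlerToQuotient K A (a • KaehlerDifferential.D K A b) =
      (T0A K A).mkQ ((2 : K)⁻¹ • (wedge K A a b + wedge K A 1 (a * b))) := by
  have h : (KaehlerDifferential.quotKerTotalEquiv K A).symm (a • KaehlerDifferential.D K A b) =
      Submodule.Quotient.mk (Finsupp.single b a) := by
    rw [LinearEquiv.symm_apply_eq]
    exact (Finsupp.linearCombination_single A a b).symm
  rw [← finsuppToQuotient_single]
  simp only [kaehlerToQuotient, LinearMap.comp_apply, LinearMap.restrictScalars_apply,
    LinearEquiv.coe_coe, h]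
  rfl

lemma kaehlerToQuotient_tensorToKaehler {t : A ⊗[K] A} (ht : t ∈ lambda2 K A) :
    kaehlerToQuotient K A (tensorToKaehler K A t) = Submodule.Quotient.mk t := by
  refine LinearMap.eqOn_span (f := kaehlerToQuotient K A ∘ₗ tensorToKaehler K A)
    (g := (T0A K A).mkQ) ?_ ht
  rintro _ ⟨a, b, rfl⟩
  rw [LinearMap.comp_apply, tensorToKaehler_wedge, map_sub, kaehlerToQuotient_smul_D,
    kaehlerToQuotient_smul_D, ← map_sub, wedge_swap K A a b, mul_comm b a]
  congr 1
  module

end KaehlerWedge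

/-- The linear map `γ_A : Λ²(A) → Ω¹(A)` determined by
`γ_A(a ∧ b) = a·d_A(b) - b·d_A(a)` is well defined (it exists) and surjective,
and its kernel equals `T₀(A)`. -/
theorem statement0 (K : Type*) [Field K] [CharZero K]
    (A : Type*) [CommRing A] [Algebra K A] :
    (∃ γ : ↥(lambda2 K A) →ₗ[K] Ω[A⁄K],
      ∀ a b : A, γ ⟨wedge K A a b, wedge_mem K a b⟩ =
        a • (KaehlerDifferential.D K A b) - b • (KaehlerDifferential.D K A a)) ∧
    ∀ γ : ↥(lambda2 K A) →ₗ[K] Ω[A⁄K],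
      (∀ a b : A, γ ⟨wedge K A a b, wedge_mem K a b⟩ =
        a • (KaehlerDifferential.D K A b) - b • (KaehlerDifferential.D K A a)) →
      Function.Surjective γ ∧
        ∀ t : ↥(lambda2 K A), γ t = 0 ↔ (t : A ⊗[K] A) ∈ T0A K A := by
  refine ⟨⟨(tensorToKaehler K A).domRestrict _, fun a b => tensorToKaehler_wedge K A a b⟩,
    fun γ hγ => ?_⟩
  have hγ_eq : γ = (tensorToKaehler K A).domRestrict _ := by
    refine LinearMap.ext_on (Submodule.span_span_coe_preimage) ?_
    rintro ⟨_, _⟩ ⟨a, b, rfl⟩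
    rw [hγ]
    exact (tensorToKaehler_wedge K A a b).symm
  subst hγ_eq
  refine ⟨fun ω => ?_, fun t => ⟨fun ht => ?_, fun ht => T0A_le_ker K A ht⟩⟩
  · obtain ⟨t, ht, h⟩ := map_lambda2_eq_top K A ▸ (Submodule.mem_top : ω ∈ (⊤ : Submodule K _))
    exact ⟨⟨t, ht⟩, h⟩
  · rw [← Submodule.Quotient.mk_eq_zero, ← kaehlerToQuotient_tensorToKaehler K A t.2]
    exact (congrArg _ ht).trans (map_zero _)

end CurrentPaper
end

section
/- Under the identification of Λ²(g) with (Λ²(A)⊗S²(k)) ⊕ (A⊗Λ²(k)) ⊕ (I_A⊗Λ²(k)) via P, one has: Λ²(A) ⊗ k.S²(k) + T₀(A) ⊗ (k∨k') ⊆ B₂(g), and p₁(B₂(g)) = Λ²(A) ⊗ k.S²(k) + T(A) ⊗ (k∨k'). Here k.S²(k) := span{ [x,y]∨w + y∨[x,w] : x,y,w ∈ k } ⊆ S²(k), k' := [k,k], and k∨k' := span{ x∨y : x ∈ k, y ∈ k' }. -/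
set_option linter.unusedSectionVars false
set_option synthInstance.maxHeartbeats 1000000
set_option maxHeartbeats 1000000
open scoped TensorProduct

namespace CurrentPaper

variable (K : Type*) [Field K] [CharZero K]
variable (A : Type*) [CommRing A] [Algebra K A]
variable (k : Type*) [LieRing k] [LieAlgebra K k]

/-- `k.S²(k) = span{ [x,y] ∨ w + y ∨ [x,w] } ⊆ S²(k)`. -/
noncomputable def kActS2 : Submodule K (k ⊗[K] k) :=
  Submodule.span K {t | ∃ x y w : k, t = vee K k ⁅x, y⁆ w + vee K k y ⁅x, w⁆}

/-- `k ∨ k' = span{ x ∨ y : x ∈ k, y ∈ k' } ⊆ S²(k)`. -/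
noncomputable def kVeeDer : Submodule K (k ⊗[K] k) :=
  Submodule.span K {t | ∃ x y : k, y ∈ derived K k ∧ t = vee K k x y}

/-- The subspace `Λ²(A) ⊗ k.S²(k)` of `Λ²(A) ⊗ S²(k)`. -/
noncomputable def sub1a : Submodule K (M1 K A k) :=
  Submodule.span K {t | ∃ (ω : ↥(lambda2 K A)) (s : ↥(sym2 K k)),
    (s : k ⊗[K] k) ∈ kActS2 K k ∧ t = ω ⊗ₜ[K] s}

/-- The subspace `T₀(A) ⊗ (k ∨ k')` of `Λ²(A) ⊗ S²(k)`. -/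
noncomputable def sub1b : Submodule K (M1 K A k) :=
  Submodule.span K {t | ∃ (ω : ↥(lambda2 K A)) (s : ↥(sym2 K k)),
    (ω : A ⊗[K] A) ∈ T0A K A ∧ (s : k ⊗[K] k) ∈ kVeeDer K k ∧ t = ω ⊗ₜ[K] s}

/-- The subspace `T(A) ⊗ (k ∨ k')` of `Λ²(A) ⊗ S²(k)`. -/
noncomputable def sub1c : Submodule K (M1 K A k) :=
  Submodule.span K {t | ∃ (ω : ↥(lambda2 K A)) (s : ↥(sym2 K k)),
    (ω : A ⊗[K] A) ∈ TA K A ∧ (s : k ⊗[K] k) ∈ kVeeDer K k ∧ t = ω ⊗ₜ[K] s}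

section Generators

variable {V : Type*} [AddCommGroup V] [Module K V]

/-- `x ∧ y` as an element of `Λ²(V)`. -/
noncomputable def wedgeEl (x y : V) : lambda2 K V := ⟨wedge K V x y, wedge_mem K x y⟩

/-- `x ∨ y` as an element of `S²(V)`. -/
noncomputable def veeEl (x y : V) : sym2 K V := ⟨vee K V x y, vee_mem K x y⟩

lemma wedgeEl_swap (x y : V) : wedgeEl K x y = -wedgeEl K y x := by
  ext
  simp only [wedgeEl, wedge, Submodule.coe_neg]
  module

lemma veeEl_comm (x y : V) : veeEl K x y = veeEl K y x := by
  ext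
  simp only [veeEl, vee]
  module

lemma veeEl_neg_left (x y : V) : veeEl K (-x) y = -veeEl K x y := by
  ext
  simp only [veeEl, vee, Submodule.coe_neg, TensorProduct.neg_tmul, TensorProduct.tmul_neg]
  module

lemma wedge_add_left (x x' y : V) :
    wedge K V (x + x') y = wedge K V x y + wedge K V x' y := by
  simp only [wedge, TensorProduct.add_tmul, TensorProduct.tmul_add]
  module

lemma wedge_add_right (x y y' : V) :
    wedge K V x (y + y') = wedge K V x y + wedge K V x y' := by
  simp only [wedge, TensorProduct.add_tmul, TensorProduct.tmul_add]
  module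

lemma wedge_zero_left (y : V) : wedge K V 0 y = 0 := by
  simp [wedge]

lemma wedge_zero_right (x : V) : wedge K V x 0 = 0 := by
  simp [wedge]

end Generators

lemma tmul_mem_of_mem_span {M N : Type*} [AddCommGroup M] [Module K M] [AddCommGroup N]
    [Module K N] {p : Submodule K M} {q : Submodule K N} {S : Set M} {R : Set N}
    (hS : S ⊆ p) (hR : R ⊆ q) (U : Submodule K (p ⊗[K] q))
    (h : ∀ s (hs : s ∈ S) r (hr : r ∈ R),
      (⟨s, hS hs⟩ : p) ⊗ₜ[K] (⟨r, hR hr⟩ : q) ∈ U)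
    (ω : p) (σ : q) (hω : (ω : M) ∈ Submodule.span K S) (hσ : (σ : N) ∈ Submodule.span K R) :
    ω ⊗ₜ[K] σ ∈ U := by
  have hSp : Submodule.span K S ≤ p := Submodule.span_le.mpr hS
  have hRq : Submodule.span K R ≤ q := Submodule.span_le.mpr hR
  obtain ⟨ω, hωp⟩ := ω
  obtain ⟨σ, hσq⟩ := σ
  change ω ∈ Submodule.span K S at hω
  change σ ∈ Submodule.span K R at hσ
  induction hω using Submodule.span_induction with
  | mem s hs =>
    induction hσ using Submodule.span_induction with
    | mem r hr => exact h s hs r hr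
    | zero =>
      have : (⟨0, hσq⟩ : q) = 0 := rfl
      rw [this, TensorProduct.tmul_zero]
      exact U.zero_mem
    | add r r' hr hr' ih ih' =>
      have := U.add_mem (ih (hRq hr)) (ih' (hRq hr'))
      rwa [← TensorProduct.tmul_add] at this
    | smul c r hr ih =>
      have := U.smul_mem c (ih (hRq hr))
      rwa [← TensorProduct.tmul_smul] at this
  | zero =>
    have : (⟨0, hωp⟩ : p) = 0 := rfl
    rw [this, TensorProduct.zero_tmul]
    exact U.zero_mem
  | add r r' hr hr' ih ih' =>
    have := U.add_mem (ih (hSp hr)) (ih' (hSp hr'))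
    rwa [← TensorProduct.add_tmul] at this
  | smul c r hr ih =>
    have := U.smul_mem c (ih (hSp hr))
    rwa [TensorProduct.smul_tmul'] at this

section Boundary

variable {L : Type*} [LieRing L] [Module K L]

lemma dd_rotate (u v w : L) : dd K L u v w = dd K L v w u := by
  simp only [dd]
  abel

lemma dd_zero_left (v w : L) : dd K L 0 v w = 0 := by
  simp [dd, wedge_zero_left, wedge_zero_right]

lemma dd_add_left (u u' v w : L) : dd K L (u + u') v w = dd K L u v w + dd K L u' v w := by
  simp only [dd, add_lie, lie_add, wedge_add_left, wedge_add_right]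
  abel

end Boundary

section CurrentBoundary

variable {A k}

lemma dd_mem_of_tmul (U : Submodule K ((A ⊗[K] k) ⊗[K] (A ⊗[K] k)))
    (h : ∀ (a b c : A) (x y z : k), dd K (A ⊗[K] k) (a ⊗ₜ x) (b ⊗ₜ y) (c ⊗ₜ z) ∈ U)
    (u v w : A ⊗[K] k) : dd K (A ⊗[K] k) u v w ∈ U := by
  induction u using TensorProduct.induction_on with
  | zero => rw [dd_zero_left]; exact U.zero_mem
  | add u u' ih ih' => rw [dd_add_left]; exact U.add_mem ih ih'
  | tmul a x =>
    rw [dd_rotate]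
    induction v using TensorProduct.induction_on with
    | zero => rw [dd_zero_left]; exact U.zero_mem
    | add u u' ih ih' => rw [dd_add_left]; exact U.add_mem ih ih'
    | tmul b y =>
      rw [dd_rotate]
      induction w using TensorProduct.induction_on with
      | zero => rw [dd_zero_left]; exact U.zero_mem
      | add u u' ih ih' => rw [dd_add_left]; exact U.add_mem ih ih'
      | tmul c z => rw [dd_rotate]; exact h a b c x y z

/-- `a ∨ b - ab ∨ 1` as an element of `I_A`. -/
noncomputable def iaEl (a b : A) : ia K A := ⟨vee K A a b - vee K A (a * b) 1, ia_el_mem K a b⟩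

lemma iaEl_comm (a b : A) : iaEl K a b = iaEl K b a := by
  ext
  simp only [iaEl, vee, mul_comm b a]
  module

lemma iaEl_one_right (a : A) : iaEl K a 1 = 0 := by
  ext
  simp [iaEl]

lemma iaEl_one_left (a : A) : iaEl K 1 a = 0 := by
  rw [iaEl_comm, iaEl_one_right]

/-- `[x,y] ∨ w + y ∨ [x,w]`, the action of `x` on `y ∨ w`. -/
noncomputable def actEl (x y w : k) : sym2 K k := veeEl K ⁅x, y⁆ w + veeEl K y ⁅x, w⁆

/-- `ab ∧ c + bc ∧ a + ca ∧ b` as an element of `Λ²(A)`. -/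
noncomputable def tEl (a b c : A) : lambda2 K A :=
  wedgeEl K (a * b) c + wedgeEl K (b * c) a + wedgeEl K (c * a) b

/-- The image of `∂(ax ∧ by ∧ cz)` under the decomposition. -/
noncomputable def ddW (a b c : A) (x y z : k) : Wspace K A k :=
  (tEl K a b c ⊗ₜ veeEl K ⁅x, y⁆ z + wedgeEl K (b * c) a ⊗ₜ actEl K y x z
      - wedgeEl K (c * a) b ⊗ₜ actEl K x z y,
    (a * b * c) ⊗ₜ (wedgeEl K ⁅x, y⁆ z + wedgeEl K ⁅y, z⁆ x + wedgeEl K ⁅z, x⁆ y),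
    iaEl K (a * b) c ⊗ₜ wedgeEl K ⁅x, y⁆ z + iaEl K (b * c) a ⊗ₜ wedgeEl K ⁅y, z⁆ x
      + iaEl K (c * a) b ⊗ₜ wedgeEl K ⁅z, x⁆ y)

lemma veeEl_lie_swap (x y z : k) : veeEl K ⁅x, y⁆ z = -veeEl K ⁅y, x⁆ z := by
  rw [← veeEl_neg_left, lie_skew]

variable {K}

lemma IsDecomposition.apply_dd {P : ↥(lambda2 K (A ⊗[K] k)) ≃ₗ[K] Wspace K A k}
    (hP : IsDecomposition K P) (a b c : A) (x y z : k) :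
    P ⟨dd K (A ⊗[K] k) (a ⊗ₜ x) (b ⊗ₜ y) (c ⊗ₜ z), dd_mem_lambda2 K _ _ _⟩ =
      ddW K a b c x y z := by
  have key : (⟨dd K (A ⊗[K] k) (a ⊗ₜ x) (b ⊗ₜ y) (c ⊗ₜ z), dd_mem_lambda2 K _ _ _⟩ :
      lambda2 K (A ⊗[K] k)) =
      ⟨wedge K (A ⊗[K] k) ((a * b) ⊗ₜ ⁅x, y⁆) (c ⊗ₜ z), wedge_mem K _ _⟩
      + ⟨wedge K (A ⊗[K] k) ((b * c) ⊗ₜ ⁅y, z⁆) (a ⊗ₜ x), wedge_mem K _ _⟩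
      + ⟨wedge K (A ⊗[K] k) ((c * a) ⊗ₜ ⁅z, x⁆) (b ⊗ₜ y), wedge_mem K _ _⟩ := by
    ext
    simp [dd, LieAlgebra.ExtendScalars.bracket_tmul]
  rw [key, map_add, map_add, hP, hP, hP]
  change ((wedgeEl K (a * b) c ⊗ₜ veeEl K ⁅x, y⁆ z,
      (a * b * c) ⊗ₜ wedgeEl K ⁅x, y⁆ z, iaEl K (a * b) c ⊗ₜ wedgeEl K ⁅x, y⁆ z) +
    (wedgeEl K (b * c) a ⊗ₜ veeEl K ⁅y, z⁆ x,
      (b * c * a) ⊗ₜ wedgeEl K ⁅y, z⁆ x, iaEl K (b * c) a ⊗ₜ wedgeEl K ⁅y, z⁆ x) +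
    (wedgeEl K (c * a) b ⊗ₜ veeEl K ⁅z, x⁆ y,
      (c * a * b) ⊗ₜ wedgeEl K ⁅z, x⁆ y, iaEl K (c * a) b ⊗ₜ wedgeEl K ⁅z, x⁆ y) :
    Wspace K A k) = _
  refine Prod.ext ?_ (Prod.ext ?_ rfl)
  · simp only [ddW, Prod.fst_add, actEl, tEl, TensorProduct.add_tmul, TensorProduct.tmul_add]
    rw [veeEl_lie_swap K y x z, veeEl_lie_swap K x z y, veeEl_comm K x ⁅y, z⁆,
      veeEl_comm K z ⁅x, y⁆, TensorProduct.tmul_neg, TensorProduct.tmul_neg]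
    abel
  · have h₁ : b * c * a = a * b * c := by ring
    have h₂ : c * a * b = a * b * c := by ring
    simp only [ddW, Prod.fst_add, Prod.snd_add, h₁, h₂, TensorProduct.tmul_add]

variable {U : Submodule K (Wspace K A k)}

lemma sub_mem_wspace {u v : Wspace K A k} (hu : u ∈ U) (hv : v ∈ U) : u - v ∈ U := by
  have h : u - v = u + (-1 : K) • v := by module
  rw [h]
  exact U.add_mem hu (U.smul_mem _ hv)

lemma act_mem (hU : ∀ (a b c : A) (x y z : k), ddW K a b c x y z ∈ U) (a b : A) (x y w : k) :
    ((wedgeEl K a b ⊗ₜ actEl K x y w, 0, 0) : Wspace K A k) ∈ U := by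
  have h : ((wedgeEl K a b ⊗ₜ actEl K x y w, 0, 0) : Wspace K A k) =
      (2 : K)⁻¹ • (ddW K 1 a b x y w - ddW K 1 b a x y w) := by
    refine Prod.ext ?_ (Prod.ext ?_ ?_)
    · simp only [ddW, tEl, Prod.smul_fst, Prod.fst_sub, one_mul, mul_one, mul_comm b a]
      have h₁ : actEl K x w y = actEl K x y w := by
        simp only [actEl]
        rw [veeEl_comm K ⁅x, w⁆, veeEl_comm K w, add_comm]
      rw [h₁, wedgeEl_swap K b a]
      simp only [TensorProduct.add_tmul, TensorProduct.neg_tmul]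
      module
    · simp [ddW, mul_comm b a]
    · simp [ddW, mul_comm b a, iaEl_comm K b a, iaEl_one_right]
  rw [h]
  exact U.smul_mem _ (sub_mem_wspace (hU ..) (hU ..))

lemma ia_wedge_mem (hU : ∀ (a b c : A) (x y z : k), ddW K a b c x y z ∈ U)
    (a b : A) (x y z : k) :
    ((0, 0, iaEl K a b ⊗ₜ wedgeEl K ⁅x, y⁆ z) : Wspace K A k) ∈ U := by
  have key : ∀ x y z : k, ((0, 0, iaEl K a b ⊗ₜ (wedgeEl K ⁅y, z⁆ x + wedgeEl K ⁅z, x⁆ y)) :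
      Wspace K A k) ∈ U := by
    intro x y z
    have h : ((0, 0, iaEl K a b ⊗ₜ (wedgeEl K ⁅y, z⁆ x + wedgeEl K ⁅z, x⁆ y)) :
        Wspace K A k) = ddW K a b 1 x y z - ddW K (a * b) 1 1 x y z
          - (wedgeEl K b a ⊗ₜ actEl K y x z, 0, 0) + (wedgeEl K a b ⊗ₜ actEl K x z y, 0, 0)
          + (wedgeEl K 1 (a * b) ⊗ₜ actEl K y x z, 0, 0)
          - (wedgeEl K (a * b) 1 ⊗ₜ actEl K x z y, 0, 0) := by
      refine Prod.ext ?_ (Prod.ext ?_ ?_)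
      · simp only [ddW, tEl, Prod.fst_sub, Prod.fst_add, one_mul, mul_one]
        rw [wedgeEl_swap K b a, wedgeEl_swap K 1 (a * b)]
        simp only [TensorProduct.add_tmul, TensorProduct.neg_tmul]
        abel
      · simp [ddW]
      · simp [ddW, iaEl_comm K b a, iaEl_one_right, iaEl_one_left, TensorProduct.tmul_add]
        abel
    rw [h]
    exact sub_mem_wspace (U.add_mem (U.add_mem (sub_mem_wspace (sub_mem_wspace (hU ..) (hU ..))
      (act_mem hU ..)) (act_mem hU ..)) (act_mem hU ..)) (act_mem hU ..)
  have h : ((0, 0, iaEl K a b ⊗ₜ wedgeEl K ⁅x, y⁆ z) : Wspace K A k) = (2 : K)⁻¹ •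
      ((0, 0, iaEl K a b ⊗ₜ (wedgeEl K ⁅z, x⁆ y + wedgeEl K ⁅x, y⁆ z)) +
      (0, 0, iaEl K a b ⊗ₜ (wedgeEl K ⁅x, y⁆ z + wedgeEl K ⁅y, z⁆ x)) -
      (0, 0, iaEl K a b ⊗ₜ (wedgeEl K ⁅y, z⁆ x + wedgeEl K ⁅z, x⁆ y))) := by
    refine Prod.ext (by simp) (Prod.ext (by simp) ?_)
    simp only [Prod.smul_snd, Prod.snd_add, Prod.snd_sub, TensorProduct.tmul_add]
    module
  rw [h]
  exact U.smul_mem _ (sub_mem_wspace (U.add_mem (key y z x) (key z x y)) (key x y z))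

lemma t0_vee_mem (hU : ∀ (a b c : A) (x y z : k), ddW K a b c x y z ∈ U)
    (a b c : A) (x y z : k) :
    (((tEl K a b c - wedgeEl K (a * b * c) 1) ⊗ₜ veeEl K ⁅x, y⁆ z, 0, 0) : Wspace K A k) ∈ U := by
  have h : (((tEl K a b c - wedgeEl K (a * b * c) 1) ⊗ₜ veeEl K ⁅x, y⁆ z, 0, 0) :
      Wspace K A k) = ddW K a b c x y z - ddW K (a * b * c) 1 1 x y z
        - (wedgeEl K (b * c) a ⊗ₜ actEl K y x z, 0, 0)
        + (wedgeEl K (c * a) b ⊗ₜ actEl K x z y, 0, 0)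
        + (wedgeEl K 1 (a * b * c) ⊗ₜ actEl K y x z, 0, 0)
        - (wedgeEl K (a * b * c) 1 ⊗ₜ actEl K x z y, 0, 0)
        - (0, 0, iaEl K (a * b) c ⊗ₜ wedgeEl K ⁅x, y⁆ z)
        - (0, 0, iaEl K (b * c) a ⊗ₜ wedgeEl K ⁅y, z⁆ x)
        - (0, 0, iaEl K (c * a) b ⊗ₜ wedgeEl K ⁅z, x⁆ y) := by
    refine Prod.ext ?_ (Prod.ext ?_ ?_)
    · simp only [ddW, Prod.fst_sub, Prod.fst_add, one_mul, mul_one]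
      have h₁ : tEl K (a * b * c) 1 1 = wedgeEl K (a * b * c) 1 := by
        simp only [tEl, one_mul, mul_one]
        rw [wedgeEl_swap K 1 (a * b * c)]
        abel
      rw [h₁, TensorProduct.sub_tmul]
      abel
    · simp [ddW]
    · simp only [ddW, Prod.snd_sub, Prod.snd_add, one_mul, mul_one, iaEl_one_right, iaEl_one_left,
        TensorProduct.zero_tmul]
      abel
  rw [h]
  exact sub_mem_wspace (sub_mem_wspace (sub_mem_wspace (sub_mem_wspace (U.add_mem (U.add_mem (sub_mem_wspace
    (sub_mem_wspace (hU ..) (hU ..)) (act_mem hU ..)) (act_mem hU ..)) (act_mem hU ..))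
    (act_mem hU ..)) (ia_wedge_mem hU ..)) (ia_wedge_mem hU ..)) (ia_wedge_mem hU ..)

lemma kVeeDer_eq_span : kVeeDer K k = Submodule.span K {t | ∃ x y z : k, t = vee K k ⁅x, y⁆ z} := by
  refine le_antisymm (Submodule.span_le.mpr ?_) (Submodule.span_le.mpr ?_)
  · rintro _ ⟨z, y, hy, rfl⟩
    induction hy using Submodule.span_induction with
    | mem y hy =>
      obtain ⟨u, v, rfl⟩ := hy
      refine Submodule.subset_span ⟨u, v, z, ?_⟩
      simp only [vee, add_comm]
    | zero => simp [vee]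
    | add y y' _ _ ih ih' =>
      have h : vee K k z (y + y') = vee K k z y + vee K k z y' := by
        simp only [vee, TensorProduct.add_tmul, TensorProduct.tmul_add]
        module
      rw [h]
      exact Submodule.add_mem _ ih ih'
    | smul c y _ ih =>
      have h : vee K k z (c • y) = c • vee K k z y := by
        simp only [vee, TensorProduct.smul_tmul', TensorProduct.tmul_smul, smul_add,
          smul_comm c (2 : K)⁻¹]
      rw [h]
      exact Submodule.smul_mem _ c ih
  · rintro _ ⟨x, y, z, rfl⟩
    refine Submodule.subset_span ⟨z, ⁅x, y⁆, Submodule.subset_span ⟨x, y, rfl⟩, ?_⟩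
    simp only [vee, add_comm]

lemma sub1a_le {N : Submodule K (M1 K A k)}
    (h : ∀ (a b : A) (x y w : k), wedgeEl K a b ⊗ₜ actEl K x y w ∈ N) : sub1a K A k ≤ N := by
  refine Submodule.span_le.mpr ?_
  rintro _ ⟨ω, σ, hσ, rfl⟩
  refine tmul_mem_of_mem_span K (p := lambda2 K A) (q := sym2 K k) Submodule.subset_span ?_ N ?_ ω σ
    ω.2 hσ
  · rintro _ ⟨x, y, w, rfl⟩
    exact (actEl K x y w).2
  · rintro _ ⟨a, b, rfl⟩ _ ⟨x, y, w, rfl⟩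
    exact h a b x y w

lemma sub1b_le {N : Submodule K (M1 K A k)}
    (h : ∀ (a b c : A) (x y z : k),
      (tEl K a b c - wedgeEl K (a * b * c) 1) ⊗ₜ veeEl K ⁅x, y⁆ z ∈ N) : sub1b K A k ≤ N := by
  refine Submodule.span_le.mpr ?_
  rintro _ ⟨ω, σ, hω, hσ, rfl⟩
  rw [kVeeDer_eq_span] at hσ
  refine tmul_mem_of_mem_span K (p := lambda2 K A) (q := sym2 K k) ?_ ?_ N ?_ ω σ hω hσ
  · rintro _ ⟨a, b, c, rfl⟩
    exact T0A_el_mem_lambda2 K a b c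
  · rintro _ ⟨x, y, z, rfl⟩
    exact vee_mem K _ _
  · rintro _ ⟨a, b, c, rfl⟩ _ ⟨x, y, w, rfl⟩
    exact h a b c x y w

lemma sub1c_le {N : Submodule K (M1 K A k)}
    (h : ∀ (a b c : A) (x y z : k), tEl K a b c ⊗ₜ veeEl K ⁅x, y⁆ z ∈ N) : sub1c K A k ≤ N := by
  refine Submodule.span_le.mpr ?_
  rintro _ ⟨ω, σ, hω, hσ, rfl⟩
  rw [kVeeDer_eq_span] at hσ
  refine tmul_mem_of_mem_span K (p := lambda2 K A) (q := sym2 K k) ?_ ?_ N ?_ ω σ hω hσ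
  · rintro _ ⟨a, b, c, rfl⟩
    exact TA_el_mem_lambda2 K a b c
  · rintro _ ⟨x, y, z, rfl⟩
    exact vee_mem K _ _
  · rintro _ ⟨a, b, c, rfl⟩ _ ⟨x, y, w, rfl⟩
    exact h a b c x y w

lemma wedgeEl_tmul_actEl_mem_sub1a (a b : A) (x y w : k) :
    wedgeEl K a b ⊗ₜ actEl K x y w ∈ sub1a K A k :=
  Submodule.subset_span ⟨_, _, Submodule.subset_span ⟨x, y, w, rfl⟩, rfl⟩

lemma tEl_tmul_veeEl_mem_sub1c (a b c : A) (x y z : k) :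
    tEl K a b c ⊗ₜ veeEl K ⁅x, y⁆ z ∈ sub1c K A k := by
  refine Submodule.subset_span ⟨_, _, Submodule.subset_span ⟨a, b, c, rfl⟩, ?_, rfl⟩
  rw [kVeeDer_eq_span]
  exact Submodule.subset_span ⟨x, y, z, rfl⟩

lemma ddW_fst_mem (a b c : A) (x y z : k) :
    (ddW K a b c x y z).1 ∈ sub1a K A k ⊔ sub1c K A k := by
  have h : (ddW K a b c x y z).1 = tEl K a b c ⊗ₜ veeEl K ⁅x, y⁆ z +
      wedgeEl K (b * c) a ⊗ₜ actEl K y x z + wedgeEl K b (c * a) ⊗ₜ actEl K x z y := by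
    rw [wedgeEl_swap K b, TensorProduct.neg_tmul]
    exact sub_eq_add_neg _ _
  rw [h]
  exact Submodule.add_mem _
    (Submodule.add_mem _ (Submodule.mem_sup_right (tEl_tmul_veeEl_mem_sub1c a b c x y z))
      (Submodule.mem_sup_left (wedgeEl_tmul_actEl_mem_sub1a _ _ _ _ _)))
    (Submodule.mem_sup_left (wedgeEl_tmul_actEl_mem_sub1a _ _ _ _ _))

end CurrentBoundary

/-- `Λ²(A) ⊗ k.S²(k) + T₀(A) ⊗ (k ∨ k') ⊆ B₂(g)` and
`p₁(B₂(g)) = Λ²(A) ⊗ k.S²(k) + T(A) ⊗ (k ∨ k')`. -/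
theorem statement3
    (P : ↥(lambda2 K (A ⊗[K] k)) ≃ₗ[K] Wspace K A k) (hP : IsDecomposition K P) :
    (∀ t : M1 K A k, t ∈ sub1a K A k ⊔ sub1b K A k →
      ((P.symm (t, 0, 0) : ↥(lambda2 K (A ⊗[K] k))) : (A ⊗[K] k) ⊗[K] (A ⊗[K] k)) ∈
        B2 K (A ⊗[K] k)) ∧
    Submodule.map ((LinearMap.fst K (M1 K A k) (M2 K A k × M3 K A k)).comp P.toLinearMap)
        ((B2 K (A ⊗[K] k)).comap (lambda2 K (A ⊗[K] k)).subtype) =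
      sub1a K A k ⊔ sub1c K A k := by
  set B := (B2 K (A ⊗[K] k)).comap (lambda2 K (A ⊗[K] k)).subtype
  have hU : ∀ (a b c : A) (x y z : k), ddW K a b c x y z ∈ B.map P.toLinearMap :=
    fun a b c x y z => ⟨_, dd_mem_B2 K _ _ _, hP.apply_dd a b c x y z⟩
  refine ⟨fun t ht => ?_, le_antisymm ?_ (sup_le ?_ ?_)⟩
  · have hle : sub1a K A k ⊔ sub1b K A k ≤
        (B.map P.toLinearMap).comap (LinearMap.inl K (M1 K A k) (M2 K A k × M3 K A k)) :=
      sup_le (sub1a_le (act_mem hU)) (sub1b_le (t0_vee_mem hU))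
    obtain ⟨u, hu, hut⟩ := hle ht
    have : P.symm (t, 0, 0) = u := P.symm_apply_eq.mpr hut.symm
    rw [this]
    exact hu
  · rw [Submodule.map_le_iff_le_comap]
    set N := (sub1a K A k ⊔ sub1c K A k).comap
      ((LinearMap.fst K (M1 K A k) (M2 K A k × M3 K A k)).comp P.toLinearMap)
    have hle : B2 K (A ⊗[K] k) ≤ N.map (lambda2 K (A ⊗[K] k)).subtype := by
      refine Submodule.span_le.mpr ?_
      rintro _ ⟨u, v, w, rfl⟩
      refine dd_mem_of_tmul K _ (fun a b c x y z => ?_) u v w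
      refine Submodule.mem_map.mpr ⟨⟨_, dd_mem_lambda2 K _ _ _⟩, ?_, rfl⟩
      change (P _).1 ∈ sub1a K A k ⊔ sub1c K A k
      rw [hP.apply_dd]
      exact ddW_fst_mem a b c x y z
    intro u hu
    obtain ⟨v, hv, hvu⟩ := hle hu
    rwa [← Subtype.ext hvu]
  · refine sub1a_le fun a b x y w => ?_
    rw [Submodule.map_comp]
    exact ⟨_, act_mem hU a b x y w, rfl⟩
  · rw [Submodule.map_comp]
    refine sub1c_le fun a b c x y z => ?_
    have h := hU a b c x y z
    have h' := ((B.map P.toLinearMap).add_mem (sub_mem_wspace h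
      (act_mem hU (b * c) a y x z)) (act_mem hU (c * a) b x z y))
    refine ⟨_, h', ?_⟩
    simp [ddW]
    abel

end CurrentPaper
end

section
/- A linear map f = f₁∘p₁ + f₂∘p₂ + f₃∘p₃: Λ²(g) → z is a 2-cocycle (i.e. vanishes on B₂(g)) if and only if the following four conditions hold: (a) f̃₁(a,b) is an invariant symmetric bilinear map for all a,b ∈ A, i.e. im(f̃₁) ⊆ Sym²(k,z)^k; (b) for every t ∈ T₀(A) and all x ∈ k, y ∈ k', f₁(t ⊗ x∨y) = 0; (c) for every a ∈ A and all x,y,w ∈ k, −f̃₂(a)(∂(x∧y∧w)) = f̃₁(a,1)([x,y],w), i.e. d_k(f̃₂(a)) = Γ(f̃₁(a,1)); (d) for every c ∈ I_A and all x ∈ k, y ∈ k', f̃₃(c)(x,y) = 0. -/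
set_option linter.unusedSectionVars false
set_option synthInstance.maxHeartbeats 1000000
set_option maxHeartbeats 1000000
open scoped TensorProduct

namespace CurrentPaper

variable (K : Type*) [Field K] [CharZero K]
variable (A : Type*) [CommRing A] [Algebra K A]
variable (k : Type*) [LieRing k] [LieAlgebra K k]
variable (z : Type*) [AddCommGroup z] [Module K z]

/-- A `z`-valued linear map on `Λ²(g)` is a 2-cocycle iff it vanishes on `B₂(g)`. -/
def IsCocycle (F : ↥(lambda2 K (A ⊗[K] k)) → z) : Prop :=
  ∀ t : ↥(lambda2 K (A ⊗[K] k)),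
    (t : (A ⊗[K] k) ⊗[K] (A ⊗[K] k)) ∈ B2 K (A ⊗[K] k) → F t = 0

/-- The alternating bilinear map `(x, y) ↦ x ∧ y` with values in `Λ²(V)`. -/
noncomputable def wedgeBilin (V : Type*) [AddCommGroup V] [Module K V] :
    V →ₗ[K] V →ₗ[K] ↥(lambda2 K V) :=
  LinearMap.mk₂ K (fun x y => ⟨wedge K V x y, wedge_mem K x y⟩)
    (fun x y w => Subtype.ext (by
      simp only [wedge, TensorProduct.add_tmul, TensorProduct.tmul_add, Submodule.coe_add]; module))
    (fun c x y => Subtype.ext (by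
      simp only [wedge, TensorProduct.smul_tmul', TensorProduct.tmul_smul, Submodule.coe_smul,
        smul_sub, smul_comm c]))
    (fun x y w => Subtype.ext (by
      simp only [wedge, TensorProduct.add_tmul, TensorProduct.tmul_add, Submodule.coe_add]; module))
    (fun c x y => Subtype.ext (by
      simp only [wedge, TensorProduct.smul_tmul', TensorProduct.tmul_smul, Submodule.coe_smul,
        smul_sub, smul_comm c]))

/-- The symmetric bilinear map `(x, y) ↦ x ∨ y` with values in `S²(V)`. -/
noncomputable def veeBilin (V : Type*) [AddCommGroup V] [Module K V] :
    V →ₗ[K] V →ₗ[K] ↥(sym2 K V) :=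
  LinearMap.mk₂ K (fun x y => ⟨vee K V x y, vee_mem K x y⟩)
    (fun x y w => Subtype.ext (by
      simp only [vee, TensorProduct.add_tmul, TensorProduct.tmul_add, Submodule.coe_add]; module))
    (fun c x y => Subtype.ext (by
      simp only [vee, TensorProduct.smul_tmul', TensorProduct.tmul_smul, Submodule.coe_smul,
        smul_add, smul_comm c]))
    (fun x y w => Subtype.ext (by
      simp only [vee, TensorProduct.add_tmul, TensorProduct.tmul_add, Submodule.coe_add]; module))
    (fun c x y => Subtype.ext (by
      simp only [vee, TensorProduct.smul_tmul', TensorProduct.tmul_smul, Submodule.coe_smul,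
        smul_add, smul_comm c]))

/-- The element `a ∨ b - ab ∨ 1` of `I_A`. -/
noncomputable def iaElement (a b : A) : ↥(ia K A) :=
  ⟨vee K A a b - vee K A (a * b) 1, ia_el_mem K a b⟩

section

variable {V : Type*} [AddCommGroup V] [Module K V]

lemma wedgeBilin_apply (x y : V) :
    wedgeBilin K V x y = ⟨wedge K V x y, wedge_mem K x y⟩ := rfl

lemma veeBilin_apply (x y : V) : veeBilin K V x y = ⟨vee K V x y, vee_mem K x y⟩ := rfl

lemma wedgeBilin_swap (x y : V) : wedgeBilin K V x y = -wedgeBilin K V y x :=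
  Subtype.ext (by simp only [wedgeBilin_apply, wedge, Submodule.coe_neg]; module)

lemma veeBilin_swap (x y : V) : veeBilin K V x y = veeBilin K V y x :=
  Subtype.ext (by simp only [veeBilin_apply, vee]; module)

end

variable {A k z}

section

variable {M N : Type*} [AddCommGroup M] [Module K M] [AddCommGroup N] [Module K N]

lemma map_neg_tmul (f : M ⊗[K] N →ₗ[K] z) (m : M) (n : N) :
    f ((-m) ⊗ₜ[K] n) = -f (m ⊗ₜ[K] n) :=
  map_neg (f ∘ₗ (TensorProduct.mk K M N).flip n) m

lemma map_tmul_neg (f : M ⊗[K] N →ₗ[K] z) (m : M) (n : N) :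
    f (m ⊗ₜ[K] (-n)) = -f (m ⊗ₜ[K] n) :=
  map_neg (f ∘ₗ TensorProduct.mk K M N m) n

end

lemma iaElement_swap (a b : A) : iaElement K A a b = iaElement K A b a :=
  Subtype.ext (by simp only [iaElement, vee, mul_comm b a]; module)

lemma iaElement_one (a : A) : iaElement K A a 1 = 0 :=
  Subtype.ext (by simp [iaElement])

/-- A linear map on `I_A` vanishes if it vanishes on the elements `a ∨ b - ab ∨ 1`. -/
lemma map_eq_zero_of_iaElement (φ : ↥(ia K A) →ₗ[K] z)
    (h : ∀ a b, φ (iaElement K A a b) = 0) (c : ↥(ia K A)) : φ c = 0 := by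
  have key : ∀ t ∈ sym2 K A, ∃ c : ↥(ia K A),
      (c : A ⊗[K] A) = t - vee K A (LinearMap.mul' K A t) 1 ∧ φ c = 0 := by
    intro t ht
    induction ht using Submodule.span_induction with
    | mem t ht =>
      obtain ⟨a, b, rfl⟩ := ht
      refine ⟨iaElement K A a b, ?_, h a b⟩
      have : LinearMap.mul' K A (vee K A a b) = a * b := by
        simp only [vee, map_smul, map_add, LinearMap.mul'_apply, mul_comm b a]
        module
      rw [this]
      rfl
    | zero => exact ⟨0, by simp [vee], map_zero φ⟩
    | add s t _ _ hs ht =>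
      obtain ⟨c, hc, hc'⟩ := hs
      obtain ⟨d, hd, hd'⟩ := ht
      refine ⟨c + d, ?_, by rw [map_add, hc', hd', add_zero]⟩
      simp only [Submodule.coe_add, hc, hd, map_add, vee, TensorProduct.add_tmul,
        TensorProduct.tmul_add]
      module
    | smul r t _ ht =>
      obtain ⟨c, hc, hc'⟩ := ht
      refine ⟨r • c, ?_, by rw [map_smul, hc', smul_zero]⟩
      simp only [Submodule.coe_smul, hc, map_smul, vee, ← TensorProduct.smul_tmul',
        TensorProduct.tmul_smul]
      module
  obtain ⟨hc, hc'⟩ := Submodule.mem_inf.mp c.2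
  obtain ⟨d, hd, hd'⟩ := key c hc
  rw [LinearMap.mem_ker.mp hc'] at hd
  have : d = c := Subtype.ext (by simp [hd, vee])
  rw [← this, hd']

/-- A linear map on `Λ²(A)` vanishes on `T₀(A)` if it vanishes on its generators. -/
lemma map_T0A_eq_zero (φ : ↥(lambda2 K A) →ₗ[K] z)
    (h : ∀ a b c, φ (wedgeBilin K A (a * b) c + wedgeBilin K A (b * c) a +
      wedgeBilin K A (c * a) b - wedgeBilin K A (a * b * c) 1) = 0)
    (t : ↥(lambda2 K A)) (ht : (t : A ⊗[K] A) ∈ T0A K A) : φ t = 0 := by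
  have hle : T0A K A ≤ (LinearMap.ker φ).map (lambda2 K A).subtype := by
    refine Submodule.span_le.mpr ?_
    rintro _ ⟨a, b, c, rfl⟩
    exact ⟨_, h a b c, rfl⟩
  obtain ⟨s, hs, hst⟩ := hle ht
  rwa [← Subtype.ext (a1 := s) (a2 := t) hst]

/-- A linear map on `k` vanishes on `k'` if it vanishes on brackets. -/
lemma map_derived_eq_zero (φ : k →ₗ[K] z) (h : ∀ x y : k, φ ⁅x, y⁆ = 0) (y : k)
    (hy : y ∈ derived K k) : φ y = 0 := by
  have hle : derived K k ≤ LinearMap.ker φ := by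
    refine Submodule.span_le.mpr ?_
    rintro _ ⟨x, y, rfl⟩
    exact h x y
  exact hle hy

/-- Vanishing on `B₂(g)` may be tested on boundaries of pure tensors. -/
lemma isCocycle_iff (F : ↥(lambda2 K (A ⊗[K] k)) →ₗ[K] z) :
    IsCocycle K A k z (fun t => F t) ↔ ∀ (a b c : A) (x y w : k),
      F (wedgeBilin K (A ⊗[K] k) ((a * b) ⊗ₜ ⁅x, y⁆) (c ⊗ₜ w)) +
      F (wedgeBilin K (A ⊗[K] k) ((b * c) ⊗ₜ ⁅y, w⁆) (a ⊗ₜ x)) +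
      F (wedgeBilin K (A ⊗[K] k) ((c * a) ⊗ₜ ⁅w, x⁆) (b ⊗ₜ y)) = 0 := by
  constructor
  · intro h a b c x y w
    rw [← map_add, ← map_add]
    exact h _ (dd_mem_B2 K (a ⊗ₜ[K] x) (b ⊗ₜ[K] y) (c ⊗ₜ[K] w))
  · intro h t ht
    have hd : ∀ u v w : A ⊗[K] k, F (wedgeBilin K (A ⊗[K] k) ⁅u, v⁆ w) +
        F (wedgeBilin K (A ⊗[K] k) ⁅v, w⁆ u) + F (wedgeBilin K (A ⊗[K] k) ⁅w, u⁆ v) = 0 := by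
      intro u v w
      induction u using TensorProduct.induction_on with
      | zero => simp
      | add u₁ u₂ h₁ h₂ =>
        simp only [add_lie, lie_add, map_add, LinearMap.add_apply]
        linear_combination (norm := module) h₁ + h₂
      | tmul a x =>
        induction v using TensorProduct.induction_on with
        | zero => simp
        | add u₁ u₂ h₁ h₂ =>
          simp only [add_lie, lie_add, map_add, LinearMap.add_apply]
          linear_combination (norm := module) h₁ + h₂
        | tmul b y =>
          induction w using TensorProduct.induction_on with
          | zero => simp
          | add u₁ u₂ h₁ h₂ =>
            simp only [add_lie, lie_add, map_add, LinearMap.add_apply]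
            linear_combination (norm := module) h₁ + h₂
          | tmul c w => exact h a b c x y w
    have hle : B2 K (A ⊗[K] k) ≤ (LinearMap.ker F).map (lambda2 K (A ⊗[K] k)).subtype := by
      refine Submodule.span_le.mpr ?_
      rintro _ ⟨u, v, w, rfl⟩
      refine ⟨⟨dd K _ u v w, dd_mem_lambda2 K u v w⟩, ?_, rfl⟩
      have := hd u v w
      rwa [← map_add, ← map_add] at this
    obtain ⟨s, hs, hst⟩ := hle ht
    rw [← Subtype.ext (a1 := s) (a2 := t) hst]
    exact hs

/-- The separation of the cocycle identity on pure tensors into its three components. -/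
lemma cocycle_identity_iff (𝕜 : Type*) [Field 𝕜] [CharZero 𝕜] {A X z : Type*} [Monoid A]
    [AddCommGroup z] [Module 𝕜 z] (u s : A → A → X → X → X → z) (v : A → X → X → X → z)
    (hu : ∀ a b x y w, u a b x y w = -u b a x y w)
    (hs : ∀ a b x y w, s a b x y w = s b a x y w)
    (hs1 : ∀ a x y w, s a 1 x y w = 0)
    (hv : ∀ a x y w, v a x y w = v a y w x) :
    (∀ a b c x y w, u (a * b) c x y w + u (b * c) a y w x + u (c * a) b w x y +
        v (a * b * c) x y w +
        (s (a * b) c x y w + s (b * c) a y w x + s (c * a) b w x y) = 0) ↔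
      (∀ a b x y w, u a b x y w = u a b y w x) ∧
      (∀ a b c x y w, u (a * b) c x y w + u (b * c) a x y w + u (c * a) b x y w -
        u (a * b * c) 1 x y w = 0) ∧
      (∀ a x y w, -v a x y w = u a 1 x y w) ∧
      (∀ a b x y w, s a b x y w = 0) := by
  constructor
  · intro H
    have h1 : ∀ a x y w, u a 1 x y w - u a 1 y w x + u a 1 w x y + v a x y w = 0 := by
      intro a x y w
      have h := H a 1 1 x y w
      simp only [mul_one, one_mul, hs1, hs 1 a] at h
      linear_combination (norm := module) h - hu 1 a y w x
    have hc1 : ∀ a x y w, u a 1 x y w = u a 1 y w x := by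
      intro a x y w
      linear_combination (norm := module) (2 : 𝕜)⁻¹ • (h1 a x y w - h1 a w x y + hv a w x y)
    have hc : ∀ a x y w, -v a x y w = u a 1 x y w := by
      intro a x y w
      linear_combination (norm := module) -h1 a x y w - hc1 a y w x
    have h2 : ∀ a b x y w,
        u a b w x y - u a b y w x + (s a b w x y + s a b y w x) = 0 := by
      intro a b x y w
      have h := H a b 1 x y w
      simp only [mul_one, one_mul, hs1] at h
      linear_combination (norm := module) h + hc (a * b) x y w - hu b a y w x - hs b a y w x
    have h3 : ∀ a b x y w, u a b w x y = u a b y w x := by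
      intro a b x y w
      linear_combination (norm := module) (2 : 𝕜)⁻¹ • (h2 a b x y w - h2 b a x y w
        + hu b a w x y - hu b a y w x + hs b a w x y + hs b a y w x)
    have ha : ∀ a b x y w, u a b x y w = u a b y w x := fun a b x y w => by
      rw [h3 a b y w x]; exact h3 a b x y w
    have h4 : ∀ a b x y w, s a b w x y + s a b y w x = 0 := by
      intro a b x y w
      linear_combination (norm := module) h2 a b x y w - h3 a b x y w
    have hd : ∀ a b x y w, s a b x y w = 0 := by
      intro a b x y w
      linear_combination (norm := module) (2 : 𝕜)⁻¹ • (h4 a b y w x + h4 a b w x y - h4 a b x y w)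
    refine ⟨ha, fun a b c x y w => ?_, hc, hd⟩
    have h := H a b c x y w
    simp only [hd] at h
    linear_combination (norm := module) h + hc (a * b * c) x y w + ha (b * c) a x y w
      - ha (c * a) b w x y
  · rintro ⟨ha, hb, hc, hd⟩ a b c x y w
    simp only [hd]
    linear_combination (norm := module) hb a b c x y w - hc (a * b * c) x y w - ha (b * c) a x y w
      + ha (c * a) b w x y

variable (A k z)

/-- **description of cocycles.** `f = f₁∘p₁ + f₂∘p₂ + f₃∘p₃` is a 2-cocycle
iff (a) all `f̃₁(a,b)` are invariant, (b) `f̃₁(T₀(A))` vanishes on `k × k'`,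
(c) `d_k(f̃₂(a)) = Γ(f̃₁(a,1))` for all `a`, and (d) `f̃₃(I_A)` vanishes on `k × k'`. -/
theorem statement7
    (P : ↥(lambda2 K (A ⊗[K] k)) ≃ₗ[K] Wspace K A k) (hP : IsDecomposition K P)
    (f1 : M1 K A k →ₗ[K] z) (f2 : M2 K A k →ₗ[K] z) (f3 : M3 K A k →ₗ[K] z) :
    IsCocycle K A k z (fun t => f1 (P t).1 + f2 (P t).2.1 + f3 (P t).2.2) ↔
      ((∀ (a b : A) (x y w : k),
          f1 (⟨wedge K A a b, wedge_mem K a b⟩ ⊗ₜ[K] ⟨vee K k ⁅x, y⁆ w, vee_mem K _ _⟩) =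
            f1 (⟨wedge K A a b, wedge_mem K a b⟩ ⊗ₜ[K] ⟨vee K k x ⁅y, w⁆, vee_mem K _ _⟩)) ∧
       (∀ t : ↥(lambda2 K A), (t : A ⊗[K] A) ∈ T0A K A → ∀ x y : k, y ∈ derived K k →
          f1 (t ⊗ₜ[K] ⟨vee K k x y, vee_mem K x y⟩) = 0) ∧
       (∀ (a : A) (x y w : k),
          -(f2 (a ⊗ₜ[K] ⟨dd K k x y w, dd_mem_lambda2 K x y w⟩)) =
            f1 (⟨wedge K A a 1, wedge_mem K a 1⟩ ⊗ₜ[K]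
                ⟨vee K k ⁅x, y⁆ w, vee_mem K _ _⟩)) ∧
       (∀ (c : ↥(ia K A)) (x y : k), y ∈ derived K k →
          f3 (c ⊗ₜ[K] ⟨wedge K k x y, wedge_mem K x y⟩) = 0)) := by
  let u : A → A → k → k → k → z := fun a b x y w =>
    f1 (wedgeBilin K A a b ⊗ₜ[K] veeBilin K k ⁅x, y⁆ w)
  let s : A → A → k → k → k → z := fun a b x y w =>
    f3 (iaElement K A a b ⊗ₜ[K] wedgeBilin K k ⁅x, y⁆ w)
  let v : A → k → k → k → z := fun a x y w =>
    f2 (a ⊗ₜ[K] (wedgeBilin K k ⁅x, y⁆ w + wedgeBilin K k ⁅y, w⁆ x + wedgeBilin K k ⁅w, x⁆ y))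
  have hcore := cocycle_identity_iff K u s v
    (fun a b x y w => by
      simp only [u]; rw [wedgeBilin_swap K a b, map_neg_tmul])
    (fun a b x y w => by simp only [s]; rw [iaElement_swap])
    (fun a x y w => by simp only [s]; rw [iaElement_one, TensorProduct.zero_tmul, map_zero])
    (fun a x y w => by simp only [v]; congr 2; abel)
  let F : ↥(lambda2 K (A ⊗[K] k)) →ₗ[K] z :=
    (f1.coprod (f2.coprod f3)).comp P.toLinearMap
  have hF : (fun t => f1 (P t).1 + f2 (P t).2.1 + f3 (P t).2.2) = fun t => F t := by
    funext t
    simp [F, add_assoc]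
  have hFt : ∀ (a b : A) (x y : k), F (wedgeBilin K (A ⊗[K] k) (a ⊗ₜ x) (b ⊗ₜ y)) =
      f1 (wedgeBilin K A a b ⊗ₜ[K] veeBilin K k x y) +
      f2 ((a * b) ⊗ₜ[K] wedgeBilin K k x y) +
      f3 (iaElement K A a b ⊗ₜ[K] wedgeBilin K k x y) := by
    intro a b x y
    rw [← congrFun hF, wedgeBilin_apply, hP a b x y]
    rfl
  have hid : IsCocycle K A k z (fun t => F t) ↔
      ∀ a b c x y w, u (a * b) c x y w + u (b * c) a y w x + u (c * a) b w x y +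
        v (a * b * c) x y w +
        (s (a * b) c x y w + s (b * c) a y w x + s (c * a) b w x y) = 0 := by
    rw [isCocycle_iff]
    refine forall_congr' fun a => forall_congr' fun b => forall_congr' fun c =>
      forall_congr' fun x => forall_congr' fun y => forall_congr' fun w => ?_
    rw [hFt, hFt, hFt, show b * c * a = a * b * c by ring, show c * a * b = a * b * c by ring]
    simp only [u, v, s, TensorProduct.tmul_add, map_add]
    constructor <;> intro h <;> linear_combination (norm := module) h
  rw [hF, hid, hcore]
  refine and_congr ?_ (and_congr ?_ (and_congr Iff.rfl ?_))
  · refine forall_congr' fun a => forall_congr' fun b => forall_congr' fun x =>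
      forall_congr' fun y => forall_congr' fun w => ?_
    simp only [u]
    rw [veeBilin_swap K ⁅y, w⁆ x]
    rfl
  · constructor
    · intro h t ht x y hy
      refine map_derived_eq_zero K (f1 ∘ₗ TensorProduct.mk K _ _ t ∘ₗ veeBilin K k x)
        (fun p q => ?_) y hy
      refine map_T0A_eq_zero K
        (f1 ∘ₗ (TensorProduct.mk K _ _).flip (veeBilin K k x ⁅p, q⁆)) (fun a b c => ?_) t ht
      have := h a b c p q x
      simp only [u, veeBilin_swap K _ x] at this
      rw [map_sub, map_add, map_add]
      exact this
    · intro h a b c x y w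
      have := h (wedgeBilin K A (a * b) c + wedgeBilin K A (b * c) a +
        wedgeBilin K A (c * a) b - wedgeBilin K A (a * b * c) 1)
        (Submodule.subset_span ⟨a, b, c, rfl⟩) w ⁅x, y⁆ (Submodule.subset_span ⟨x, y, rfl⟩)
      rw [← veeBilin_apply, veeBilin_swap] at this
      simpa only [u, TensorProduct.add_tmul, TensorProduct.sub_tmul, map_add, map_sub] using this
  · constructor
    · intro h c x y hy
      refine map_derived_eq_zero K (f3 ∘ₗ TensorProduct.mk K _ _ c ∘ₗ wedgeBilin K k x)
        (fun p q => ?_) y hy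
      refine map_eq_zero_of_iaElement K
        (f3 ∘ₗ (TensorProduct.mk K _ _).flip (wedgeBilin K k x ⁅p, q⁆)) (fun a b => ?_) c
      have := h a b p q x
      simp only [s] at this
      rw [wedgeBilin_swap, map_tmul_neg, neg_eq_zero] at this
      exact this
    · intro h a b x y w
      have := h (iaElement K A a b) w ⁅x, y⁆ (Submodule.subset_span ⟨x, y, rfl⟩)
      rw [← wedgeBilin_apply, wedgeBilin_swap, map_tmul_neg, neg_eq_zero] at this
      exact this

end CurrentPaper
end
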